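/- Let 1 < σ ≤ 1.15 and set σ1 = 1/2 + (1/2)·√(1+4σ²). Then F(σ,1) − κ·F(σ1,1) ≤ 1/(σ−1) + 0.0215, where σ and σ1 are regarded as real points (i.e. the arguments have imaginary part 0). -/

import Mathlib

namespace ZFR

noncomputable def kappa : ℝ := 1 / Real.sqrt 5

noncomputable def sigma1 (σ : ℝ) : ℝ := 1 / 2 + Real.sqrt (1 + 4 * σ ^ 2) / 2

/-- `F(s,z) = Re( 1/(s-z) + 1/(s-1+conj z) )`. -/
noncomputable def F (s z : ℂ) : ℝ :=
  (1 / (s - z) + 1 / (s - 1 + (starRingEnd ℂ) z)).re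

theorem F_ofReal_one (x : ℝ) : F (x : ℂ) 1 = 1 / (x - 1) + 1 / x := by
  have h : (1 / ((x : ℂ) - 1) + 1 / ((x : ℂ) - 1 + (starRingEnd ℂ) 1))
      = ((1 / (x - 1) + 1 / x : ℝ) : ℂ) := by
    push_cast
    simp
  rw [F, h, Complex.ofReal_re]

theorem F_sigma1_one {σ : ℝ} (hσ : 0 < σ) :
    F (sigma1 σ : ℂ) 1 = Real.sqrt (1 + 4 * σ ^ 2) / σ ^ 2 := by
  have hs : Real.sqrt (1 + 4 * σ ^ 2) ^ 2 = 1 + 4 * σ ^ 2 := Real.sq_sqrt (by positivity)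
  have hprod : (sigma1 σ - 1) * sigma1 σ = σ ^ 2 := by
    rw [sigma1]
    linear_combination hs / 4
  have hne : (sigma1 σ - 1) * sigma1 σ ≠ 0 := by
    rw [hprod]
    positivity
  rw [F_ofReal_one, div_add_div _ _ (left_ne_zero_of_mul hne) (right_ne_zero_of_mul hne), hprod,
    sigma1]
  ring

theorem sqrt_five_mul_le {σ : ℝ} (hσ : 1 < σ) (hσ' : σ ≤ 1.15) :
    Real.sqrt 5 * (σ - 0.0215 * σ ^ 2) ≤ Real.sqrt (1 + 4 * σ ^ 2) := by
  apply Real.le_sqrt_of_sq_le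
  rw [mul_pow, Real.sq_sqrt (by norm_num)]
  norm_num at hσ' ⊢
  have h₁ : 0 ≤ (23 / 20 - σ) * (σ - 1) := mul_nonneg (by linarith) (by linarith)
  have h₂ : 0 ≤ (23 / 20 - σ) * (σ - 1) * σ := mul_nonneg h₁ (by linarith)
  have h₃ : 0 ≤ (23 / 20 - σ) * (σ - 1) * σ ^ 2 := mul_nonneg h₁ (by positivity)
  nlinarith

/-- For `1 < σ ≤ 1.15`, `F(σ,1) - κ F(σ1,1) ≤ 1/(σ-1) + 0.0215`. -/
theorem pole_term_real (σ : ℝ) (hσ : 1 < σ) (hσ' : σ ≤ 1.15) :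
    F (σ : ℂ) 1 - kappa * F ((sigma1 σ : ℂ)) 1 ≤ 1 / (σ - 1) + 0.0215 := by
  have h₀ : 0 < σ := by linarith
  have h₅ : 0 < Real.sqrt 5 := by positivity
  have key : 1 / σ - 0.0215 ≤ kappa * (Real.sqrt (1 + 4 * σ ^ 2) / σ ^ 2) := by
    calc 1 / σ - 0.0215 = Real.sqrt 5 * (σ - 0.0215 * σ ^ 2) / (Real.sqrt 5 * σ ^ 2) := by
          field_simp
      _ ≤ Real.sqrt (1 + 4 * σ ^ 2) / (Real.sqrt 5 * σ ^ 2) := by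
          gcongr
          exact sqrt_five_mul_le hσ hσ'
      _ = kappa * (Real.sqrt (1 + 4 * σ ^ 2) / σ ^ 2) := by
          rw [kappa]
          field_simp
  rw [F_ofReal_one, F_sigma1_one h₀]
  linarith

end ZFR
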